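/- arXiv:2112.13035 — 2 statements merged into one kernel-verified Lean document; each statement's English description precedes it below -/
import Mathlib

section
/- Finite extinction time for coercive absolutely 1-homogeneous gradient flows: let H be a real Hilbert space, J : H → [0,∞] proper, convex, lower semicontinuous and absolutely 1-homogeneous, coercive with constant λ₁ > 0. Let u₀ ∈ H with u₀ ⊥ N(J), and let u be a strong solution of the gradient flow with initial datum u₀. Then u(t) = 0 for every t ≥ ‖u₀‖/λ₁; in particular the extinction time T_ex(u₀) := inf{ T ≥ 0 : u(t) = 0 for all t ≥ T } satisfies T_ex(u₀) ≤ ‖u₀‖/λ₁. -/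
open MeasureTheory Filter Topology
open scoped ENNReal RealInnerProductSpace

variable {H : Type*} [NormedAddCommGroup H] [InnerProductSpace ℝ H] [CompleteSpace H]

/-- `J` is proper: it is not identically `+∞`. -/
def IsProperFn (J : H → ℝ≥0∞) : Prop := ∃ u, J u ≠ ⊤

/-- Convexity of an `[0,∞]`-valued functional. -/
def IsConvexFn (J : H → ℝ≥0∞) : Prop :=
  ∀ (x y : H) (a b : ℝ), 0 ≤ a → 0 ≤ b → a + b = 1 →
    J (a • x + b • y) ≤ ENNReal.ofReal a * J x + ENNReal.ofReal b * J y

/-- Absolute 1-homogeneity: `J(λu) = |λ|·J(u)`. -/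
def AbsOneHomogeneous (J : H → ℝ≥0∞) : Prop :=
  ∀ (c : ℝ) (u : H), J (c • u) = ENNReal.ofReal |c| * J u

/-- The null space `N(J) = {w : J(w) = 0}`. -/
def NullSpace (J : H → ℝ≥0∞) : Set H := {w | J w = 0}

/-- `u ⊥ N(J)`. -/
def PerpNullSpace (J : H → ℝ≥0∞) (u : H) : Prop := ∀ w ∈ NullSpace J, ⟪u, w⟫ = 0

/-- Coercivity with constant `λ₁`: `λ₁‖w‖ ≤ J(w)` for every `w ⊥ N(J)`. -/
def CoerciveWith (J : H → ℝ≥0∞) (lam : ℝ) : Prop :=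
  ∀ w : H, PerpNullSpace J w → ENNReal.ofReal (lam * ‖w‖) ≤ J w

/-- `v ∈ ∂J(u)`: the subdifferential inequality `J(w) ≥ J(u) + ⟨v, w − u⟩` for all `w`. -/
def MemSubdiffFn (J : H → ℝ≥0∞) (u v : H) : Prop :=
  ∀ w : H, (J u : EReal) + ((⟪v, w - u⟫ : ℝ) : EReal) ≤ (J w : EReal)

/-- A strong solution of the gradient flow `u' ∈ −∂J(u)`: continuous on `[0,∞)`,
locally absolutely continuous on `(0,∞)` (encoded by the fundamental theorem of
calculus with a locally integrable a.e. derivative `u'`), differentiable a.e. with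
`−u'(t) ∈ ∂J(u(t))` for a.e. `t > 0`. -/
structure GradientFlowSol (J : H → ℝ≥0∞) where
  u : ℝ → H
  u' : ℝ → H
  cont : ContinuousOn u (Set.Ici 0)
  locint : ∀ s t : ℝ, 0 < s → s ≤ t → IntervalIntegrable u' volume s t
  fund : ∀ s t : ℝ, 0 < s → s ≤ t → u t - u s = ∫ r in s..t, u' r
  deriv_ae : ∀ᵐ t : ℝ, 0 < t → HasDerivAt u (u' t) t
  subdiff_ae : ∀ᵐ t : ℝ, 0 < t → MemSubdiffFn J (u t) (-u' t)

theorem HasDerivAt.norm_of_ne_zero {E : Type*} [NormedAddCommGroup E] [InnerProductSpace ℝ E]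
    {u : ℝ → E} {v : E} {t : ℝ} (hu : HasDerivAt u v t) (h0 : u t ≠ 0) :
    HasDerivAt (fun r => ‖u r‖) (⟪u t, v⟫ / ‖u t‖) t := by
  have h := hu.norm_sq.sqrt (by simpa using h0)
  simp only [Real.sqrt_sq (norm_nonneg _)] at h
  convert! h using 1
  ring

theorem deriv_norm_eq_zero {E : Type*} [NormedAddCommGroup E] {u : ℝ → E} {t : ℝ}
    (h0 : u t = 0) : deriv (fun r => ‖u r‖) t = 0 :=
  IsLocalMin.deriv_eq_zero (Eventually.of_forall fun r => by simp [h0])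

/-- A function whose increments are dominated by those of an absolutely continuous function is
absolutely continuous. -/
theorem AbsolutelyContinuousOnInterval.of_dist_le {X Y : Type*} [PseudoMetricSpace X]
    [PseudoMetricSpace Y] {f : ℝ → X} {g : ℝ → Y} {a b : ℝ}
    (hf : AbsolutelyContinuousOnInterval f a b)
    (h : ∀ x ∈ Set.uIcc a b, ∀ y ∈ Set.uIcc a b, dist (g x) (g y) ≤ dist (f x) (f y)) :
    AbsolutelyContinuousOnInterval g a b := by
  rw [absolutelyContinuousOnInterval_iff] at hf ⊢
  intro ε hε
  obtain ⟨δ, hδ, H⟩ := hf ε hε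
  refine ⟨δ, hδ, fun E hE hlen => (Finset.sum_le_sum fun i hi => ?_).trans_lt (H E hE hlen)⟩
  exact h _ (hE.1 i hi).1 _ (hE.1 i hi).2

/-- An absolutely continuous function whose derivative is almost everywhere at most `c` grows at
rate at most `c`. -/
theorem AbsolutelyContinuousOnInterval.sub_le_of_ae_deriv_le {f : ℝ → ℝ} {a b c : ℝ}
    (hf : AbsolutelyContinuousOnInterval f a b) (hab : a ≤ b)
    (h : ∀ᵐ x, x ∈ Set.Ioc a b → deriv f x ≤ c) : f b - f a ≤ c * (b - a) := by
  rw [← hf.integral_deriv_eq_sub, mul_comm]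
  calc ∫ x in a..b, deriv f x ≤ ∫ _ in a..b, c := by
        rw [intervalIntegral.integral_of_le hab, intervalIntegral.integral_of_le hab]
        refine setIntegral_mono_on_ae ?_ ?_ measurableSet_Ioc h
        · exact (intervalIntegrable_iff_integrableOn_Ioc_of_le hab).1 hf.intervalIntegrable_deriv
        · simp
    _ = (b - a) * c := by simp

section Subdifferential

variable {J : H → ℝ≥0∞}

omit [CompleteSpace H] in
theorem AbsOneHomogeneous.map_zero (hhom : AbsOneHomogeneous J) : J 0 = 0 := by
  simpa using hhom 0 0

omit [CompleteSpace H] in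
theorem AbsOneHomogeneous.map_add_le (hhom : AbsOneHomogeneous J) (hconv : IsConvexFn J)
    (x y : H) : J (x + y) ≤ J x + J y := by
  have h2 : ENNReal.ofReal |2| * ENNReal.ofReal (1 / 2) = 1 := by
    rw [← ENNReal.ofReal_mul (by positivity)]; norm_num
  calc J (x + y) = J ((2 : ℝ) • ((1 / 2 : ℝ) • x + (1 / 2 : ℝ) • y)) := by
        congr 1
        rw [← smul_add, smul_smul]
        norm_num
    _ ≤ ENNReal.ofReal |2| * (ENNReal.ofReal (1 / 2) * J x + ENNReal.ofReal (1 / 2) * J y) := by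
        rw [hhom]
        gcongr
        exact hconv x y _ _ (by norm_num) (by norm_num) (by norm_num)
    _ = J x + J y := by
        rw [mul_add, ← mul_assoc, ← mul_assoc, h2, one_mul, one_mul]

omit [CompleteSpace H] in
theorem MemSubdiffFn.le_inner {u v : H} (h : MemSubdiffFn J u v) (hhom : AbsOneHomogeneous J) :
    J u ≤ ENNReal.ofReal ⟪v, u⟫ := by
  have h0 := h 0
  rw [hhom.map_zero, zero_sub, inner_neg_right] at h0
  have hfin : J u ≠ ⊤ := by
    intro htop
    simp [htop] at h0
  lift J u to NNReal using hfin with a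
  rw [EReal.coe_nnreal_eq_coe_real, EReal.coe_ennreal_zero] at h0
  have h1 : (a : ℝ) + -⟪v, u⟫ ≤ 0 := by exact_mod_cast h0
  rw [← ENNReal.ofReal_coe_nnreal]
  exact ENNReal.ofReal_le_ofReal (by linarith)

omit [CompleteSpace H] in
theorem MemSubdiffFn.inner_eq_zero {u v w : H} (h : MemSubdiffFn J u v)
    (hhom : AbsOneHomogeneous J) (hconv : IsConvexFn J) (hw : w ∈ NullSpace J) : ⟪v, w⟫ = 0 := by
  have key : ∀ c : ℝ, c * ⟪v, w⟫ ≤ 0 := by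
    intro c
    have hJ : J (u + c • w) ≤ J u := by
      have hw' : J w = 0 := hw
      simpa [hhom c w, hw'] using hhom.map_add_le hconv u (c • w)
    have hc := (h (u + c • w)).trans (EReal.coe_ennreal_le_coe_ennreal_iff.2 hJ)
    rw [add_sub_cancel_left, inner_smul_right] at hc
    have hfin : J u ≠ ⊤ := ne_top_of_le_ne_top ENNReal.ofReal_ne_top (h.le_inner hhom)
    lift J u to NNReal using hfin with a
    rw [EReal.coe_nnreal_eq_coe_real] at hc
    have h1 : (a : ℝ) + c * ⟪v, w⟫ ≤ a := by exact_mod_cast hc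
    linarith
  linarith [key 1, key (-1)]

end Subdifferential

namespace GradientFlowSol

variable {J : H → ℝ≥0∞}

omit [CompleteSpace H] in
/-- The norm of a strong solution is absolutely continuous on compact subintervals of `(0,∞)`. -/
theorem absolutelyContinuousOnInterval_norm (S : GradientFlowSol J) {s t : ℝ} (hs : 0 < s)
    (hst : s ≤ t) : AbsolutelyContinuousOnInterval (fun r => ‖S.u r‖) s t := by
  have hint := (S.locint s t hs hst).norm
  refine (hint.absolutelyContinuousOnInterval_intervalIntegral Set.left_mem_uIcc).of_dist_le ?_
  have hsub : ∀ x ∈ Set.uIcc s t, IntervalIntegrable (fun r => ‖S.u' r‖) volume s x :=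
    fun x hx => hint.mono_set (Set.uIcc_subset_uIcc_left hx)
  have key : ∀ x ∈ Set.uIcc s t, ∀ y ∈ Set.uIcc s t, x ≤ y →
      dist ‖S.u x‖ ‖S.u y‖ ≤ dist (∫ r in s..x, ‖S.u' r‖) (∫ r in s..y, ‖S.u' r‖) := by
    intro x hx y hy hxy
    have hx0 : 0 < x := hs.trans_le (by rw [Set.uIcc_of_le hst] at hx; exact hx.1)
    rw [dist_comm, dist_comm (∫ r in s..x, ‖S.u' r‖), Real.dist_eq, Real.dist_eq,
      intervalIntegral.integral_interval_sub_left (hsub y hy) (hsub x hx)]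
    calc |‖S.u y‖ - ‖S.u x‖| ≤ ‖S.u y - S.u x‖ := abs_norm_sub_norm_le _ _
      _ = ‖∫ r in x..y, S.u' r‖ := by rw [S.fund x y hx0 hxy]
      _ ≤ ∫ r in x..y, ‖S.u' r‖ := intervalIntegral.norm_integral_le_integral_norm hxy
      _ ≤ |∫ r in x..y, ‖S.u' r‖| := le_abs_self _
  intro x hx y hy
  rcases le_total x y with hxy | hxy
  · exact key x hx y hy hxy
  · simpa only [dist_comm] using key y hy x hx hxy

omit [CompleteSpace H] in
theorem tendsto_nhdsGT_zero (S : GradientFlowSol J) : Tendsto S.u (𝓝[>] 0) (𝓝 (S.u 0)) :=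
  (S.cont 0 Set.self_mem_Ici).mono_left (nhdsWithin_mono _ Set.Ioi_subset_Ici_self)

theorem perpNullSpace (S : GradientFlowSol J) (hhom : AbsOneHomogeneous J)
    (hconv : IsConvexFn J) (hperp : PerpNullSpace J (S.u 0)) {t : ℝ} (ht : 0 < t) :
    PerpNullSpace J (S.u t) := by
  intro w hw
  have hconst : ∀ s, 0 < s → s ≤ t → ⟪S.u s, w⟫ = ⟪S.u t, w⟫ := by
    intro s hs hst
    have hI : ⟪w, S.u t - S.u s⟫ = 0 := by
      rw [S.fund s t hs hst]
      have hcomm := (innerSL ℝ w).intervalIntegral_comp_comm (S.locint s t hs hst)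
      simp only [innerSL_apply_apply] at hcomm
      rw [← hcomm]
      refine intervalIntegral.integral_zero_ae ?_
      filter_upwards [S.subdiff_ae] with r hr hrm
      rw [Set.uIoc_of_le hst] at hrm
      have h0 := (hr (hs.trans hrm.1)).inner_eq_zero hhom hconv hw
      rwa [inner_neg_left, neg_eq_zero, real_inner_comm] at h0
    rw [inner_sub_right, real_inner_comm, real_inner_comm (S.u s) w] at hI
    linarith
  have hlim : Tendsto (fun s => ⟪S.u s, w⟫) (𝓝[>] 0) (𝓝 ⟪S.u 0, w⟫) :=
    S.tendsto_nhdsGT_zero.inner tendsto_const_nhds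
  rw [hperp w hw] at hlim
  refine tendsto_nhds_unique (tendsto_const_nhds.congr' ?_) hlim
  filter_upwards [Ioc_mem_nhdsGT ht] with s hs
  exact (hconst s hs.1 hs.2).symm

/-- As long as the solution does not vanish, its norm decreases at rate at least `lam`. -/
theorem ae_deriv_norm_le (S : GradientFlowSol J) (hhom : AbsOneHomogeneous J)
    (hconv : IsConvexFn J) {lam : ℝ} (hlam : 0 < lam)
    (hcoer : CoerciveWith J lam) (hperp : PerpNullSpace J (S.u 0)) :
    ∀ᵐ t, 0 < t → S.u t ≠ 0 → deriv (fun r => ‖S.u r‖) t ≤ -lam := by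
  filter_upwards [S.deriv_ae, S.subdiff_ae] with t hd hsub ht h0
  have hpos : 0 < ‖S.u t‖ := norm_pos_iff.2 h0
  rw [((hd ht).norm_of_ne_zero h0).deriv, div_le_iff₀ hpos]
  have hle := (hcoer _ (S.perpNullSpace hhom hconv hperp ht)).trans ((hsub ht).le_inner hhom)
  rw [ENNReal.ofReal_le_ofReal_iff', inner_neg_left, real_inner_comm] at hle
  have hmul : 0 < lam * ‖S.u t‖ := mul_pos hlam hpos
  rcases hle with hle | hle <;> linarith

/-- A solution orthogonal to the null space which has not vanished at time `t` satisfies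
`‖u(t)‖ + lam * t ≤ ‖u(0)‖`. -/
theorem norm_add_mul_le (S : GradientFlowSol J) (hhom : AbsOneHomogeneous J)
    (hconv : IsConvexFn J) {lam : ℝ} (hlam : 0 < lam) (hcoer : CoerciveWith J lam)
    (hperp : PerpNullSpace J (S.u 0)) {t : ℝ} (ht : 0 < t) (h0 : S.u t ≠ 0) :
    ‖S.u t‖ + lam * t ≤ ‖S.u 0‖ := by
  have hderiv := S.ae_deriv_norm_le hhom hconv hlam hcoer hperp
  have hne : ∀ s, 0 < s → s ≤ t → S.u s ≠ 0 := by
    intro s hs hst hzero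
    have hmono := (S.absolutelyContinuousOnInterval_norm hs hst).sub_le_of_ae_deriv_le
      (c := 0) hst (by
        filter_upwards [hderiv] with r hr hrm
        by_cases hr0 : S.u r = 0
        · exact (deriv_norm_eq_zero hr0).le
        · linarith [hr (hs.trans hrm.1) hr0])
    simp only [hzero, norm_zero, sub_zero, zero_mul] at hmono
    exact h0 (norm_le_zero_iff.1 hmono)
  have hdecay : ∀ s, 0 < s → s ≤ t → ‖S.u t‖ + lam * (t - s) ≤ ‖S.u s‖ := by
    intro s hs hst
    have h := (S.absolutelyContinuousOnInterval_norm hs hst).sub_le_of_ae_deriv_le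
      (c := -lam) hst (by
        filter_upwards [hderiv] with r hr hrm
        exact hr (hs.trans hrm.1) (hne r (hs.trans hrm.1) hrm.2))
    linarith
  have hleft : Tendsto (fun s : ℝ => ‖S.u t‖ + lam * (t - s)) (𝓝[>] 0)
      (𝓝 (‖S.u t‖ + lam * (t - 0))) :=
    (Continuous.tendsto (by fun_prop) 0).mono_left nhdsWithin_le_nhds
  rw [sub_zero] at hleft
  refine le_of_tendsto_of_tendsto hleft S.tendsto_nhdsGT_zero.norm ?_
  filter_upwards [Ioc_mem_nhdsGT ht] with s hs
  exact hdecay s hs.1 hs.2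

end GradientFlowSol

/-- finite extinction time: for a proper, convex, lsc, absolutely
1-homogeneous and coercive functional `J` on a Hilbert space, the gradient flow
starting from `u₀ ⊥ N(J)` vanishes for `t ≥ ‖u₀‖/λ₁`; in particular
`T_ex(u₀) ≤ ‖u₀‖/λ₁`. -/
theorem gradient_flow_finite_extinction {H : Type*} [NormedAddCommGroup H]
    [InnerProductSpace ℝ H] [CompleteSpace H] (J : H → ℝ≥0∞)
    (hproper : IsProperFn J) (hconv : IsConvexFn J) (hlsc : LowerSemicontinuous J)
    (hhom : AbsOneHomogeneous J) (lam : ℝ) (hlam : 0 < lam) (hcoer : CoerciveWith J lam)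
    (u₀ : H) (hperp : PerpNullSpace J u₀)
    (S : GradientFlowSol J) (hinit : S.u 0 = u₀) :
    (∀ t : ℝ, ‖u₀‖ / lam ≤ t → S.u t = 0) ∧
      sInf {T : ℝ | 0 ≤ T ∧ ∀ t : ℝ, T ≤ t → S.u t = 0} ≤ ‖u₀‖ / lam := by
  have hnonneg : 0 ≤ ‖u₀‖ / lam := by positivity
  have hzero : ∀ t : ℝ, ‖u₀‖ / lam ≤ t → S.u t = 0 := by
    subst hinit
    intro t ht
    rw [div_le_iff₀ hlam] at ht
    by_contra hne
    have hpos : 0 < ‖S.u t‖ := norm_pos_iff.2 hne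
    rcases (le_of_mul_le_mul_right (by simpa using (norm_nonneg _).trans ht) hlam :
      (0 : ℝ) ≤ t).eq_or_lt with rfl | htpos
    · linarith
    · linarith [S.norm_add_mul_le hhom hconv hlam hcoer hperp htpos hne]
  exact ⟨hzero, csInf_le ⟨0, fun _ hT => hT.1⟩ ⟨hnonneg, hzero⟩⟩
end

section
/- Explicit solution of the Neumann total variation flow for a step initial datum: let L > 0, 0 < a < L, k > 0, and set T := k·a·(L−a)/L. Define u : [0,∞) → L²(0,L) by u(t) := (k − t/a)·χ_{(0,a)} + (t/(L−a))·χ_{(a,L)} for 0 ≤ t ≤ T, and u(t) := (k·a/L)·χ_{(0,L)} for t ≥ T. Then u is a strong solution of the Neumann total variation flow on (0,L) with initial datum u₀ = k·χ_{(0,a)}. -/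
open MeasureTheory Set Filter Topology
open scoped ENNReal

/-- Lebesgue measure on the interval `(0, L)`. -/
noncomputable def muI (L : ℝ) : Measure ℝ := volume.restrict (Set.Ioo 0 L)

/-- The total variation energy `F : L²(0,L) → [0,∞]`,
`F(w) = sup { ∫_0^L w φ' : φ ∈ C_c^∞(0,L), ‖φ‖_∞ ≤ 1 }`. -/
noncomputable def Fneu (L : ℝ) (w : ℝ → ℝ) : ℝ≥0∞ :=
  ⨆ (φ : ℝ → ℝ) (_ : ContDiff ℝ (⊤ : ℕ∞) φ ∧ HasCompactSupport φ ∧ tsupport φ ⊆ Set.Ioo 0 L ∧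
      ∀ x, |φ x| ≤ 1),
    ENNReal.ofReal (∫ x in Set.Ioo 0 L, w x * deriv φ x)

/-- `v ∈ ∂F(u)`: the subdifferential inequality
`F(w) ≥ F(u) + ∫_0^L v·(w−u)` for all `w ∈ L²(0,L)`. -/
def MemSubdiffNeu (L : ℝ) (u v : Lp ℝ 2 (muI L)) : Prop :=
  ∀ w : Lp ℝ 2 (muI L),
    (Fneu L u : EReal) + ((∫ x, v x * (w x - u x) ∂(muI L) : ℝ) : EReal) ≤
      (Fneu L w : EReal)

/-- A strong solution of the Neumann total variation flow `u' ∈ −∂F(u)` on `(0,L)`: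
continuous on `[0,∞)`, locally absolutely continuous on `(0,∞)` (encoded by the
fundamental theorem of calculus with a locally integrable a.e. derivative `u'`),
differentiable a.e. with `−u'(t) ∈ ∂F(u(t))` for a.e. `t > 0`. -/
structure NeumannTVFlowSol (L : ℝ) where
  u : ℝ → Lp ℝ 2 (muI L)
  u' : ℝ → Lp ℝ 2 (muI L)
  cont : ContinuousOn u (Set.Ici 0)
  locint : ∀ s t : ℝ, 0 < s → s ≤ t → IntervalIntegrable u' volume s t
  fund : ∀ s t : ℝ, 0 < s → s ≤ t → u t - u s = ∫ r in s..t, u' r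
  deriv_ae : ∀ᵐ t : ℝ, 0 < t → HasDerivAt u (u' t) t
  subdiff_ae : ∀ᵐ t : ℝ, 0 < t → MemSubdiffNeu L (u t) (-u' t)

/-- The step function equal to `c` on `(0, a)` and to `d` on `(a, L)`. -/
noncomputable def stepFun (L a c d : ℝ) (x : ℝ) : ℝ :=
  (Set.Ioo 0 a).indicator (fun _ => c) x + (Set.Ioo a L).indicator (fun _ => d) x

instance isFiniteMeasure_muI (L : ℝ) : IsFiniteMeasure (muI L) := by
  unfold muI; infer_instance

/-- The class of `stepFun L a c d` in `L²(0, L)`. -/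
noncomputable def stepLp (L a c d : ℝ) : Lp ℝ 2 (muI L) :=
  c • indicatorConstLp 2 (measurableSet_Ioo (a := (0 : ℝ)) (b := a))
      (measure_ne_top (muI L) _) (1 : ℝ) +
  d • indicatorConstLp 2 (measurableSet_Ioo (a := a) (b := L))
      (measure_ne_top (muI L) _) (1 : ℝ)

theorem coeFn_stepLp (L a c d : ℝ) : ⇑(stepLp L a c d) =ᵐ[muI L] stepFun L a c d := by
  unfold stepLp
  filter_upwards [Lp.coeFn_add (c • indicatorConstLp 2 (measurableSet_Ioo (a := (0 : ℝ)) (b := a))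
      (measure_ne_top (muI L) _) (1 : ℝ)) (d • indicatorConstLp 2
      (measurableSet_Ioo (a := a) (b := L)) (measure_ne_top (muI L) _) (1 : ℝ)),
    Lp.coeFn_smul c (indicatorConstLp 2 (measurableSet_Ioo (a := (0 : ℝ)) (b := a))
      (measure_ne_top (muI L) _) (1 : ℝ)),
    Lp.coeFn_smul d (indicatorConstLp 2 (measurableSet_Ioo (a := a) (b := L))
      (measure_ne_top (muI L) _) (1 : ℝ)),
    indicatorConstLp_coeFn (p := 2) (hs := measurableSet_Ioo (a := (0 : ℝ)) (b := a))
      (hμs := measure_ne_top (muI L) _) (c := (1 : ℝ)),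
    indicatorConstLp_coeFn (p := 2) (hs := measurableSet_Ioo (a := a) (b := L))
      (hμs := measure_ne_top (muI L) _) (c := (1 : ℝ))] with x h h1 h2 h3 h4
  rw [h, Pi.add_apply, h1, h2, Pi.smul_apply, Pi.smul_apply, h3, h4]
  simp [stepFun, Set.indicator_apply]

theorem stepFun_mul (L a c d c' d' x : ℝ) :
    stepFun L a c d x * stepFun L a c' d' x = stepFun L a (c * c') (d * d') x := by
  simp only [stepFun, Set.indicator_apply, Set.mem_Ioo]
  split_ifs <;> grind

theorem integral_stepFun_mul {L a : ℝ} (ha : 0 < a) (haL : a < L) (c d : ℝ) {f : ℝ → ℝ}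
    (hf : Continuous f) :
    ∫ x, stepFun L a c d x * f x ∂(muI L) =
      c * (∫ x in (0 : ℝ)..a, f x) + d * ∫ x in a..L, f x := by
  have key : ∀ (p q e : ℝ), p ≤ q → Set.Ioo p q ⊆ Set.Ioo 0 L →
      Integrable (fun x => (Set.Ioo p q).indicator (fun x => e * f x) x) (muI L) ∧
      ∫ x, (Set.Ioo p q).indicator (fun x => e * f x) x ∂(muI L) = e * ∫ x in p..q, f x := by
    intro p q e hpq hsub
    constructor
    · refine IntegrableOn.integrable_indicator ?_ measurableSet_Ioo
      have : IntegrableOn (fun x => e * f x) (Set.Icc 0 L) volume :=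
        (continuous_const.mul hf).continuousOn.integrableOn_Icc
      exact Integrable.integrableOn (this.mono_set Set.Ioo_subset_Icc_self)
    · rw [integral_indicator measurableSet_Ioo, muI, Measure.restrict_restrict measurableSet_Ioo,
        Set.inter_eq_left.2 hsub, integral_const_mul, intervalIntegral.integral_of_le hpq,
        integral_Ioc_eq_integral_Ioo]
  obtain ⟨i1, e1⟩ := key 0 a c ha.le (Set.Ioo_subset_Ioo_right haL.le)
  obtain ⟨i2, e2⟩ := key a L d haL.le (Set.Ioo_subset_Ioo_left ha.le)
  rw [← e1, ← e2, ← integral_add i1 i2]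
  congr 1 with x
  simp only [stepFun, Set.indicator_apply]
  split_ifs <;> ring

theorem Fneu_stepLp_le {L a c d : ℝ} (ha : 0 < a) (haL : a < L) (hdc : d ≤ c) :
    Fneu L (stepLp L a c d) ≤ ENNReal.ofReal (c - d) := by
  refine iSup₂_le fun φ hφ => ENNReal.ofReal_le_ofReal ?_
  obtain ⟨hsm, -, hsupp, hbd⟩ := hφ
  have hd : Continuous (deriv φ) := hsm.continuous_deriv (by simp)
  have hint : ∀ p q : ℝ, ∫ x in p..q, deriv φ x = φ q - φ p := fun p q =>
    intervalIntegral.integral_deriv_eq_sub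
      (fun x _ => (hsm.differentiable (by simp)).differentiableAt) (hd.intervalIntegrable _ _)
  have h0 : φ 0 = 0 := image_eq_zero_of_notMem_tsupport fun h => lt_irrefl _ (hsupp h).1
  have hL : φ L = 0 := image_eq_zero_of_notMem_tsupport fun h => lt_irrefl _ (hsupp h).2
  have e : ∫ x in Set.Ioo 0 L, (stepLp L a c d : ℝ → ℝ) x * deriv φ x =
      ∫ x, stepFun L a c d x * deriv φ x ∂(muI L) := by
    refine integral_congr_ae ?_
    filter_upwards [coeFn_stepLp L a c d] with x hx
    rw [hx]
  rw [e, integral_stepFun_mul ha haL c d hd, hint, hint, h0, hL]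
  nlinarith [(abs_le.1 (hbd a)).2]

/-- Smooth cut-offs in `(0, 1)`, converging pointwise to `1` there. -/
noncomputable def unitCutoff (n : ℕ) (y : ℝ) : ℝ :=
  Real.smoothTransition (n * y - 1) * Real.smoothTransition (n * (1 - y) - 1)

theorem contDiff_unitCutoff (n : ℕ) : ContDiff ℝ (⊤ : ℕ∞) (unitCutoff n) := by
  unfold unitCutoff
  exact (Real.smoothTransition.contDiff.comp (by fun_prop)).mul
    (Real.smoothTransition.contDiff.comp (by fun_prop))

theorem unitCutoff_nonneg (n : ℕ) (y : ℝ) : 0 ≤ unitCutoff n y :=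
  mul_nonneg (Real.smoothTransition.nonneg _) (Real.smoothTransition.nonneg _)

theorem unitCutoff_le_one (n : ℕ) (y : ℝ) : unitCutoff n y ≤ 1 :=
  mul_le_one₀ (Real.smoothTransition.le_one _) (Real.smoothTransition.nonneg _)
    (Real.smoothTransition.le_one _)

theorem unitCutoff_eq_zero_of_left {n : ℕ} {y : ℝ} (h : n * y ≤ 1) : unitCutoff n y = 0 := by
  rw [unitCutoff, Real.smoothTransition.zero_of_nonpos (by linarith), zero_mul]

theorem unitCutoff_eq_zero_of_right {n : ℕ} {y : ℝ} (h : n * (1 - y) ≤ 1) :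
    unitCutoff n y = 0 := by
  rw [unitCutoff, Real.smoothTransition.zero_of_nonpos (x := n * (1 - y) - 1) (by linarith),
    mul_zero]

theorem unitCutoff_eq_zero_of_notMem {n : ℕ} {y : ℝ} (h : y ∉ Set.Ioo (0 : ℝ) 1) :
    unitCutoff n y = 0 := by
  have hn : (0 : ℝ) ≤ n := n.cast_nonneg
  rcases le_or_gt y 0 with h0 | h0
  · exact unitCutoff_eq_zero_of_left (by nlinarith)
  · have : 1 ≤ y := not_lt.1 fun h1 => h ⟨h0, h1⟩
    exact unitCutoff_eq_zero_of_right (by nlinarith)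

theorem tendsto_unitCutoff {y : ℝ} (hy : y ∈ Set.Ioo (0 : ℝ) 1) :
    Tendsto (fun n => unitCutoff n y) atTop (𝓝 1) := by
  have h1 : Tendsto (fun n : ℕ => (n : ℝ) * y) atTop atTop :=
    tendsto_natCast_atTop_atTop.atTop_mul_const hy.1
  have h2 : Tendsto (fun n : ℕ => (n : ℝ) * (1 - y)) atTop atTop :=
    tendsto_natCast_atTop_atTop.atTop_mul_const (sub_pos.2 hy.2)
  refine tendsto_const_nhds.congr' ?_
  filter_upwards [h1.eventually_ge_atTop 2, h2.eventually_ge_atTop 2] with n a1 a2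
  rw [unitCutoff, Real.smoothTransition.one_of_one_le (by linarith),
    Real.smoothTransition.one_of_one_le (by linarith), one_mul]

/-- The primitive of `unitCutoff n` vanishing at `0`. -/
noncomputable def unitRamp (n : ℕ) (y : ℝ) : ℝ := ∫ s in (0 : ℝ)..y, unitCutoff n s

theorem hasDerivAt_unitRamp (n : ℕ) (y : ℝ) : HasDerivAt (unitRamp n) (unitCutoff n y) y :=
  (contDiff_unitCutoff n).continuous.integral_hasStrictDerivAt 0 y |>.hasDerivAt

theorem contDiff_unitRamp (n : ℕ) : ContDiff ℝ (⊤ : ℕ∞) (unitRamp n) := by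
  rw [contDiff_infty_iff_deriv]
  refine ⟨fun y => (hasDerivAt_unitRamp n y).differentiableAt, ?_⟩
  rw [show deriv (unitRamp n) = unitCutoff n from funext fun y => (hasDerivAt_unitRamp n y).deriv]
  exact contDiff_unitCutoff n

theorem intervalIntegrable_unitCutoff (n : ℕ) (p q : ℝ) :
    IntervalIntegrable (unitCutoff n) volume p q :=
  (contDiff_unitCutoff n).continuous.intervalIntegrable _ _

theorem unitRamp_eq_zero {n : ℕ} {y : ℝ} (h : n * y ≤ 1) : unitRamp n y = 0 := by
  have hn : (0 : ℝ) ≤ n := n.cast_nonneg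
  refine intervalIntegral.integral_zero_ae (Eventually.of_forall fun s hs => ?_)
  refine unitCutoff_eq_zero_of_left ?_
  rcases le_total 0 y with h0 | h0
  · rw [uIoc_of_le h0] at hs
    nlinarith [hs.2]
  · rw [uIoc_of_ge h0] at hs
    nlinarith [hs.2]

theorem unitRamp_eq_unitRamp_one {n : ℕ} {y : ℝ} (h : n * (1 - y) ≤ 1) :
    unitRamp n y = unitRamp n 1 := by
  have hn : (0 : ℝ) ≤ n := n.cast_nonneg
  rw [unitRamp, unitRamp, ← sub_eq_zero, intervalIntegral.integral_interval_sub_left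
    (intervalIntegrable_unitCutoff n _ _) (intervalIntegrable_unitCutoff n _ _)]
  refine intervalIntegral.integral_zero_ae (Eventually.of_forall fun s hs => ?_)
  refine unitCutoff_eq_zero_of_right ?_
  rcases le_total 1 y with h0 | h0
  · rw [uIoc_of_le h0] at hs
    nlinarith [hs.1]
  · rw [uIoc_of_ge h0] at hs
    nlinarith [hs.1]

theorem unitRamp_mem_Icc (n : ℕ) (y : ℝ) : unitRamp n y ∈ Set.Icc (0 : ℝ) 1 := by
  have hn : (0 : ℝ) ≤ n := n.cast_nonneg
  have hpos : ∀ z : ℝ, 0 ≤ z → 0 ≤ unitRamp n z := fun z hz =>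
    intervalIntegral.integral_nonneg hz fun s _ => unitCutoff_nonneg n s
  have hle : ∀ z : ℝ, 0 ≤ z → unitRamp n z ≤ z := fun z hz => by
    simpa [unitRamp] using intervalIntegral.integral_mono_on hz (intervalIntegrable_unitCutoff n 0 z)
      (intervalIntegrable_const (c := (1 : ℝ))) fun s _ => unitCutoff_le_one n s
  rcases le_total y 0 with h0 | h0
  · rw [unitRamp_eq_zero (by nlinarith)]; simp
  · rcases le_total y 1 with h1 | h1
    · exact ⟨hpos y h0, (hle y h0).trans h1⟩
    · rw [unitRamp_eq_unitRamp_one (by nlinarith)]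
      exact ⟨hpos 1 zero_le_one, hle 1 zero_le_one⟩

/-- Smooth compactly supported approximations of the hat function with peak at `a`. -/
noncomputable def smoothHat (L a : ℝ) (n : ℕ) (x : ℝ) : ℝ :=
  unitRamp n (x / a) - unitRamp n ((x - a) / (L - a))

theorem hasDerivAt_smoothHat (L a : ℝ) (n : ℕ) (x : ℝ) :
    HasDerivAt (smoothHat L a n)
      (unitCutoff n (x / a) * (1 / a) - unitCutoff n ((x - a) / (L - a)) * (1 / (L - a))) x :=
  ((hasDerivAt_unitRamp n _).comp x ((hasDerivAt_id x).div_const a)).sub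
    ((hasDerivAt_unitRamp n _).comp x (((hasDerivAt_id x).sub_const a).div_const (L - a)))

theorem contDiff_smoothHat (L a : ℝ) (n : ℕ) : ContDiff ℝ (⊤ : ℕ∞) (smoothHat L a n) := by
  unfold smoothHat
  exact ((contDiff_unitRamp n).comp (by fun_prop)).sub
    ((contDiff_unitRamp n).comp (by fun_prop))

theorem abs_smoothHat_le_one (L a : ℝ) (n : ℕ) (x : ℝ) : |smoothHat L a n x| ≤ 1 := by
  obtain ⟨h1, h2⟩ := unitRamp_mem_Icc n (x / a)
  obtain ⟨h3, h4⟩ := unitRamp_mem_Icc n ((x - a) / (L - a))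
  rw [smoothHat, abs_le]
  constructor <;> linarith

theorem tsupport_smoothHat_subset {L a : ℝ} (ha : 0 < a) (haL : a < L) {n : ℕ} (hn : 0 < n) :
    tsupport (smoothHat L a n) ⊆ Set.Icc (a / n) (L - (L - a) / n) := by
  have hn' : (0 : ℝ) < n := Nat.cast_pos.2 hn
  have hLa : 0 < L - a := sub_pos.2 haL
  refine closure_minimal (fun x hx => ?_) isClosed_Icc
  by_contra hmem
  refine hx ?_
  rw [Set.mem_Icc, not_and_or, not_le, not_le] at hmem
  unfold smoothHat
  rcases hmem with h | h
  · have h' : n * (x / a) ≤ 1 := by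
      rw [lt_div_iff₀ hn'] at h
      rw [← mul_div_assoc, div_le_one ha]
      linarith
    have h'' : (x - a) / (L - a) ≤ 0 :=
      div_nonpos_of_nonpos_of_nonneg
        (by linarith [div_le_self ha.le (Nat.one_le_cast.2 hn : (1 : ℝ) ≤ n)]) hLa.le
    rw [unitRamp_eq_zero h', unitRamp_eq_zero (by nlinarith), sub_zero]
  · have h' : n * (1 - (x - a) / (L - a)) ≤ 1 := by
      have : L - x < (L - a) / n := by linarith
      rw [lt_div_iff₀ hn'] at this
      rw [one_sub_div hLa.ne', ← mul_div_assoc, div_le_one hLa]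
      linarith
    have h'' : 1 ≤ x / a := by
      rw [one_le_div ha]
      linarith [div_le_self hLa.le (Nat.one_le_cast.2 hn : (1 : ℝ) ≤ n)]
    rw [unitRamp_eq_unitRamp_one h', unitRamp_eq_unitRamp_one (by nlinarith), sub_self]

theorem tendsto_deriv_smoothHat {L a : ℝ} (ha : 0 < a) (haL : a < L) (x : ℝ) :
    Tendsto (fun n => deriv (smoothHat L a n) x) atTop
      (𝓝 (stepFun L a (1 / a) (-(1 / (L - a))) x)) := by
  have hLa : 0 < L - a := sub_pos.2 haL
  have key : ∀ (y e : ℝ) (s : Set ℝ), (y ∈ Set.Ioo (0 : ℝ) 1 ↔ x ∈ s) →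
      Tendsto (fun n => unitCutoff n y * e) atTop (𝓝 (s.indicator (fun _ => e) x)) := by
    intro y e s hs
    by_cases hx : x ∈ s
    · simpa [hx] using (tendsto_unitCutoff (hs.2 hx)).mul_const e
    · simp [hx, unitCutoff_eq_zero_of_notMem (fun h => hx (hs.1 h))]
  have h1 := key (x / a) (1 / a) (Set.Ioo 0 a) (by
    rw [Set.mem_Ioo, Set.mem_Ioo, div_lt_one ha, div_pos_iff_of_pos_right ha])
  have h2 := key ((x - a) / (L - a)) (-(1 / (L - a))) (Set.Ioo a L) (by
    rw [Set.mem_Ioo, Set.mem_Ioo, div_lt_one hLa, div_pos_iff_of_pos_right hLa, sub_pos,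
      sub_lt_sub_iff_right])
  refine (h1.add h2).congr fun n => ?_
  rw [(hasDerivAt_smoothHat L a n x).deriv]
  ring

theorem abs_deriv_smoothHat_le {L a : ℝ} (ha : 0 < a) (haL : a < L) (n : ℕ) (x : ℝ) :
    |deriv (smoothHat L a n) x| ≤ 1 / a + 1 / (L - a) := by
  have hLa : 0 < L - a := sub_pos.2 haL
  have b : ∀ y e : ℝ, 0 < e → 0 ≤ unitCutoff n y * e ∧ unitCutoff n y * e ≤ e := fun y e he =>
    ⟨mul_nonneg (unitCutoff_nonneg n y) he.le,
      mul_le_of_le_one_left he.le (unitCutoff_le_one n y)⟩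
  have h1 := b (x / a) (1 / a) (by positivity)
  have h2 := b ((x - a) / (L - a)) (1 / (L - a)) (by positivity)
  rw [(hasDerivAt_smoothHat L a n x).deriv, abs_le]
  constructor <;> linarith

theorem ofReal_integral_stepFun_mul_le_Fneu {L a : ℝ} (ha : 0 < a) (haL : a < L)
    (w : Lp ℝ 2 (muI L)) :
    ENNReal.ofReal (∫ x, stepFun L a (1 / a) (-(1 / (L - a))) x * w x ∂(muI L)) ≤ Fneu L w := by
  have hw : Integrable w (muI L) := (Lp.memLp w).integrable (by norm_num)
  have hlim : Tendsto (fun n : ℕ => ∫ x, deriv (smoothHat L a n) x * w x ∂(muI L)) atTop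
      (𝓝 (∫ x, stepFun L a (1 / a) (-(1 / (L - a))) x * w x ∂(muI L))) := by
    refine tendsto_integral_of_dominated_convergence
      (fun x => (1 / a + 1 / (L - a)) * ‖w x‖) (fun n => ?_) (hw.norm.const_mul _)
      (fun n => Eventually.of_forall fun x => ?_)
      (Eventually.of_forall fun x => (tendsto_deriv_smoothHat ha haL x).mul_const _)
    · exact ((contDiff_smoothHat L a n).continuous_deriv (by simp)).aestronglyMeasurable.mul
        hw.aestronglyMeasurable
    · rw [norm_mul]
      exact mul_le_mul_of_nonneg_right (abs_deriv_smoothHat_le ha haL n x) (norm_nonneg _)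
  refine le_of_tendsto (ENNReal.tendsto_ofReal hlim) ?_
  filter_upwards [eventually_gt_atTop 0] with n hn
  have hsub := tsupport_smoothHat_subset ha haL hn
  have hn' : (0 : ℝ) < n := Nat.cast_pos.2 hn
  have hIcc : Set.Icc (a / n) (L - (L - a) / n) ⊆ Set.Ioo 0 L := fun x hx =>
    ⟨(div_pos ha hn').trans_le hx.1, by
      linarith [hx.2, div_pos (sub_pos.2 haL) hn']⟩
  simp_rw [mul_comm (deriv _ _)]
  exact le_iSup₂_of_le (f := fun φ _ => ENNReal.ofReal (∫ x in Set.Ioo 0 L, w x * deriv φ x))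
    (smoothHat L a n) ⟨contDiff_smoothHat L a n,
      isCompact_Icc.of_isClosed_subset (isClosed_tsupport _) hsub, hsub.trans hIcc,
      abs_smoothHat_le_one L a n⟩ le_rfl

theorem memSubdiffNeu_stepLp {L a c d : ℝ} (ha : 0 < a) (haL : a < L) (hdc : d ≤ c) :
    MemSubdiffNeu L (stepLp L a c d) (stepLp L a (1 / a) (-(1 / (L - a)))) := by
  intro w
  have hLa : 0 < L - a := sub_pos.2 haL
  set V := stepFun L a (1 / a) (-(1 / (L - a))) with hV
  have hVw : Integrable (fun x => V x * w x) (muI L) :=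
    ((Lp.memLp _).ae_eq (coeFn_stepLp L a (1 / a) (-(1 / (L - a))))).integrable_mul (Lp.memLp w)
  have hVu : Integrable (fun x => V x * stepFun L a c d x) (muI L) :=
    ((Lp.memLp _).ae_eq (coeFn_stepLp L a (1 / a) (-(1 / (L - a))))).integrable_mul
      ((Lp.memLp _).ae_eq (coeFn_stepLp L a c d))
  have hu : ∫ x, V x * stepFun L a c d x ∂(muI L) = c - d := by
    have := integral_stepFun_mul ha haL (1 / a * c) (-(1 / (L - a)) * d)
      (continuous_const (y := (1 : ℝ)))
    simp only [hV, stepFun_mul]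
    simp only [mul_one, intervalIntegral.integral_const, smul_eq_mul, sub_zero] at this
    rw [this]
    field_simp
    ring
  have e : ∫ x, (stepLp L a (1 / a) (-(1 / (L - a))) : ℝ → ℝ) x *
      (w x - (stepLp L a c d : ℝ → ℝ) x) ∂(muI L) = (∫ x, V x * w x ∂(muI L)) - (c - d) := by
    rw [← hu, ← integral_sub hVw hVu]
    refine integral_congr_ae ?_
    filter_upwards [coeFn_stepLp L a c d, coeFn_stepLp L a (1 / a) (-(1 / (L - a)))] with x h1 h2
    rw [h1, h2, mul_sub]
  rw [e]
  calc (Fneu L (stepLp L a c d) : EReal) + (((∫ x, V x * w x ∂(muI L)) - (c - d) : ℝ) : EReal)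
      ≤ ((c - d : ℝ) : EReal) + (((∫ x, V x * w x ∂(muI L)) - (c - d) : ℝ) : EReal) := by
        gcongr
        have := EReal.coe_ennreal_le_coe_ennreal_iff.2 (Fneu_stepLp_le ha haL hdc)
        rwa [EReal.coe_ennreal_ofReal, max_eq_left (sub_nonneg.2 hdc)] at this
    _ = ((∫ x, V x * w x ∂(muI L) : ℝ) : EReal) := by
        rw [← EReal.coe_add]; congr 1; ring
    _ ≤ (ENNReal.ofReal (∫ x, V x * w x ∂(muI L)) : EReal) := by
        rw [EReal.coe_ennreal_ofReal]; exact EReal.coe_le_coe_iff.2 (le_max_left _ _)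
    _ ≤ (Fneu L w : EReal) :=
        EReal.coe_ennreal_le_coe_ennreal_iff.2 (ofReal_integral_stepFun_mul_le_Fneu ha haL w)

theorem memSubdiffNeu_zero {L a c : ℝ} (ha : 0 < a) (haL : a < L) :
    MemSubdiffNeu L (stepLp L a c c) 0 := by
  intro w
  have hF : Fneu L (stepLp L a c c) = 0 := by
    simpa using Fneu_stepLp_le ha haL (le_refl c)
  have hI : ∫ x, (0 : Lp ℝ 2 (muI L)) x * (w x - (stepLp L a c c : ℝ → ℝ) x) ∂(muI L) = 0 := by
    refine integral_eq_zero_of_ae ?_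
    filter_upwards [Lp.coeFn_zero ℝ 2 (muI L)] with x hx
    rw [hx, Pi.zero_apply, zero_mul]
  rw [hF, hI]
  simpa using EReal.coe_ennreal_nonneg (Fneu L w)

theorem stepLp_affine (L a c d c' d' s : ℝ) :
    stepLp L a (c + s * c') (d + s * d') = stepLp L a c d + s • stepLp L a c' d' := by
  unfold stepLp
  module

theorem neg_stepLp (L a c d : ℝ) : -stepLp L a c d = stepLp L a (-c) (-d) := by
  unfold stepLp
  module

theorem stepFun_self_ae {L a : ℝ} (ha : 0 < a) (haL : a < L) (c : ℝ) :
    stepFun L a c c =ᵐ[muI L] (Set.Ioo 0 L).indicator fun _ => c := by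
  have hne : ∀ᵐ x ∂(muI L), x ≠ a :=
    ae_restrict_of_ae (Measure.ae_ne volume a)
  filter_upwards [hne] with x hx
  simp only [stepFun, Set.indicator_apply, Set.mem_Ioo]
  grind

/-- explicit solution of the Neumann total variation flow on `(0,L)` with
step initial datum `u₀ = k·χ_{(0,a)}`: with `T = k a (L−a)/L`, one has
`u(t) = (k − t/a)χ_{(0,a)} + (t/(L−a))χ_{(a,L)}` for `0 ≤ t ≤ T` and
`u(t) = (k a/L)χ_{(0,L)}` for `t ≥ T`. -/
theorem neumann_tv_flow_explicit_step (L a k : ℝ) (ha : 0 < a) (haL : a < L) (hk : 0 < k) :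
    ∃ S : NeumannTVFlowSol L,
      (⇑(S.u 0) =ᵐ[muI L] (Set.Ioo 0 a).indicator fun _ => k) ∧
      (∀ t : ℝ, 0 ≤ t → t ≤ k * a * (L - a) / L →
        ⇑(S.u t) =ᵐ[muI L] fun x =>
          (Set.Ioo 0 a).indicator (fun _ => k - t / a) x +
          (Set.Ioo a L).indicator (fun _ => t / (L - a)) x) ∧
      (∀ t : ℝ, k * a * (L - a) / L ≤ t →
        ⇑(S.u t) =ᵐ[muI L] (Set.Ioo 0 L).indicator fun _ => k * a / L) := by
  have hL : 0 < L := ha.trans haL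
  have hLa : 0 < L - a := sub_pos.2 haL
  set T := k * a * (L - a) / L with hT
  have hTpos : 0 < T := by positivity
  have hTa : k - T / a = k * a / L := by rw [hT]; field_simp; ring
  have hTb : T / (L - a) = k * a / L := by rw [hT]; field_simp
  set g : Lp ℝ 2 (muI L) := stepLp L a (-(1 / a)) (1 / (L - a)) with hg
  set u : ℝ → Lp ℝ 2 (muI L) := fun t => stepLp L a (k - min t T / a) (min t T / (L - a)) with hu
  set u' : ℝ → Lp ℝ 2 (muI L) := (Set.Iio T).indicator fun _ => g with hu'
  have hu_eq : ∀ t, u t = stepLp L a k 0 + min t T • g := fun t => by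
    rw [hg, ← stepLp_affine]
    simp only [hu]
    congr 1 <;> ring
  have hcont : Continuous u := by
    rw [show u = fun t => stepLp L a k 0 + min t T • g from funext hu_eq]
    fun_prop
  have hderiv : ∀ t, t ≠ T → HasDerivAt u (u' t) t := by
    intro t ht
    rcases lt_or_gt_of_ne ht with h | h
    · have h1 : HasDerivAt (fun t : ℝ => stepLp L a k 0 + t • g) ((1 : ℝ) • g) t :=
        ((hasDerivAt_id t).smul_const g).const_add _
      rw [hu', Set.indicator_of_mem (Set.mem_Iio.2 h), ← one_smul ℝ g]
      refine h1.congr_of_eventuallyEq ?_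
      filter_upwards [Iio_mem_nhds h] with s hs
      rw [hu_eq, min_eq_left (le_of_lt hs)]
    · rw [hu', Set.indicator_of_notMem (by simpa using h.le)]
      refine (hasDerivAt_const t (stepLp L a k 0 + T • g)).congr_of_eventuallyEq ?_
      filter_upwards [Ioi_mem_nhds h] with s hs
      rw [hu_eq, min_eq_right (le_of_lt hs)]
  have hint : ∀ s t : ℝ, IntervalIntegrable u' volume s t := fun s t =>
    ⟨(intervalIntegrable_const (c := g)).1.indicator measurableSet_Iio,
      (intervalIntegrable_const (c := g)).2.indicator measurableSet_Iio⟩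
  have hne : ∀ᵐ t : ℝ, t ≠ T := Measure.ae_ne volume T
  have hstep : ∀ t, t ≤ T → u t = stepLp L a (k - t / a) (t / (L - a)) := fun t ht => by
    simp only [hu, min_eq_left ht]
  have hflat : ∀ t, T ≤ t → u t = stepLp L a (k * a / L) (k * a / L) := fun t ht => by
    simp only [hu, min_eq_right ht, hTa, hTb]
  refine ⟨⟨u, u', hcont.continuousOn, fun s t _ _ => hint s t, fun s t _ hst => ?_, ?_, ?_⟩,
    ?_, ?_, ?_⟩
  · exact (integral_eq_of_hasDerivAt_off_countable u u' (Set.countable_singleton T)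
      hcont.continuousOn (fun x hx => hderiv x hx.2) (hint s t)).symm
  · filter_upwards [hne] with t ht _
    exact hderiv t ht
  · filter_upwards [hne] with t ht _
    rcases lt_or_gt_of_ne ht with h | h
    · rw [hstep t h.le, hu', Set.indicator_of_mem (Set.mem_Iio.2 h), hg, neg_stepLp, neg_neg]
      refine memSubdiffNeu_stepLp ha haL ?_
      calc t / (L - a) ≤ T / (L - a) := by gcongr
        _ = k - T / a := by rw [hTa, hTb]
        _ ≤ k - t / a := by gcongr
    · rw [hflat t h.le, hu', Set.indicator_of_notMem (by simpa using h.le), neg_zero]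
      exact memSubdiffNeu_zero ha haL
  · change ⇑(u 0) =ᵐ[muI L] _
    rw [hstep 0 hTpos.le]
    refine (coeFn_stepLp _ _ _ _).trans (Eventually.of_forall fun x => ?_)
    simp [stepFun]
  · intro t _ ht
    change ⇑(u t) =ᵐ[muI L] _
    rw [hstep t ht]
    exact coeFn_stepLp _ _ _ _
  · intro t ht
    change ⇑(u t) =ᵐ[muI L] _
    rw [hflat t ht]
    exact (coeFn_stepLp _ _ _ _).trans (stepFun_self_ae ha haL _)
end
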